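/- arXiv:1008.1699 — 2 statements merged into one kernel-verified Lean document; each statement's English description precedes it below -/
import Mathlib

section
/- There is an absolute constant (namely 4) such that for every continuously differentiable function u : ℝ → ℝ with compact support, ∫_ℝ u(t)² e^{−t} dt ≤ 4 ∫_ℝ u′(t)² e^{−t} dt. -/
/-- Integration by parts: the derivative of `u² e^{-t}` integrates to zero. -/
theorem integral_deriv_sq_mul_exp_neg_eq_zero {u : ℝ → ℝ} (hu : ContDiff ℝ 1 u)
    (hsupp : HasCompactSupport u) :
    ∫ t : ℝ, (2 * u t * deriv u t - (u t) ^ 2) * Real.exp (-t) = 0 := by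
  have hc := hu.continuous
  have hc' := hu.continuous_deriv le_rfl
  refine MeasureTheory.integral_eq_zero_of_hasDerivAt_of_integrable
    (f := fun t ↦ (u t) ^ 2 * Real.exp (-t)) (fun t ↦ ?_)
    (Continuous.integrable_of_hasCompactSupport (by fun_prop)
      (hsupp.mono fun t ht hut ↦ ht (by simp [hut])))
    (Continuous.integrable_of_hasCompactSupport (by fun_prop)
      (hsupp.mono fun t ht hut ↦ ht (by simp [hut])))
  have hd := (hu.differentiable one_ne_zero t).hasDerivAt
  refine ((hd.pow 2).mul (hasDerivAt_neg t).exp).congr_deriv ?_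
  simp only [Pi.pow_apply]
  ring

/-- Weighted Hardy-type inequality: for every `C¹` compactly supported
`u : ℝ → ℝ`, `∫ u² e^{-t} dt ≤ 4 ∫ (u')² e^{-t} dt`. -/
theorem weighted_hardy_inequality (u : ℝ → ℝ) (hu : ContDiff ℝ 1 u)
    (hsupp : HasCompactSupport u) :
    ∫ t : ℝ, (u t) ^ 2 * Real.exp (-t) ≤ 4 * ∫ t : ℝ, (deriv u t) ^ 2 * Real.exp (-t) := by
  have hc := hu.continuous
  have hc' := hu.continuous_deriv le_rfl
  have hsq : MeasureTheory.Integrable fun t ↦ (u t) ^ 2 * Real.exp (-t) :=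
    Continuous.integrable_of_hasCompactSupport (by fun_prop)
      (hsupp.mono fun t ht hut ↦ ht (by simp [hut]))
  have hderiv : MeasureTheory.Integrable fun t ↦
      (2 * u t * deriv u t - (u t) ^ 2) * Real.exp (-t) :=
    Continuous.integrable_of_hasCompactSupport (by fun_prop)
      (hsupp.mono fun t ht hut ↦ ht (by simp [hut]))
  have hsq' : MeasureTheory.Integrable fun t ↦ (deriv u t) ^ 2 * Real.exp (-t) :=
    Continuous.integrable_of_hasCompactSupport (by fun_prop)
      (hsupp.deriv.mono fun t ht hut ↦ ht (by simp [hut]))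
  calc ∫ t : ℝ, (u t) ^ 2 * Real.exp (-t)
      = ∫ t : ℝ, ((u t) ^ 2 * Real.exp (-t)
          + 2 * ((2 * u t * deriv u t - (u t) ^ 2) * Real.exp (-t))) := by
        rw [MeasureTheory.integral_add hsq (hderiv.const_mul 2),
          MeasureTheory.integral_const_mul, integral_deriv_sq_mul_exp_neg_eq_zero hu hsupp]
        ring
    _ ≤ ∫ t : ℝ, 4 * ((deriv u t) ^ 2 * Real.exp (-t)) := by
        refine MeasureTheory.integral_mono (hsq.add (hderiv.const_mul 2))
          (hsq'.const_mul 4) fun t ↦ ?_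
        have hnonneg := mul_nonneg (sq_nonneg (2 * deriv u t - u t)) (Real.exp_pos (-t)).le
        dsimp only
        linarith
    _ = 4 * ∫ t : ℝ, (deriv u t) ^ 2 * Real.exp (-t) := MeasureTheory.integral_const_mul _ _
end

section
/- Let n ≥ 2 and 0 < ε < 1, and define the weight φ(x) = −log|x| + |x|^ε for x ∈ ℝⁿ ∖ {0}. There exist positive constants R₀, C, C₁, C₂, depending only on n and ε, such that for every W : ℝⁿ → ℝ of class C¹, every u ∈ C_c^∞(B(0,R₀) ∖ {0}) and every τ ≥ C₁·√(‖W‖_{C¹}) + C₂, one has C·‖ |x|² e^{τφ} (Δu + W u) ‖_{L²} ≥ τ^{3/2}·‖ |x|^{ε/2} e^{τφ} u ‖_{L²} + τ^{1/2}·‖ |x|^{1+ε/2} e^{τφ} |∇u| ‖_{L²}. -/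
open MeasureTheory Metric

/-- The Euclidean Laplacian `Δf = Σᵢ ∂²f/∂xᵢ²`. -/
noncomputable def eLap {n : ℕ} (f : EuclideanSpace ℝ (Fin n) → ℝ)
    (x : EuclideanSpace ℝ (Fin n)) : ℝ :=
  ∑ i : Fin n,
    fderiv ℝ (fun y => fderiv ℝ f y (EuclideanSpace.single i 1)) x (EuclideanSpace.single i 1)

/-- The `L²` norm of a function on `ℝⁿ` (with respect to Lebesgue measure). -/
noncomputable def eL2 {n : ℕ} (g : EuclideanSpace ℝ (Fin n) → ℝ) : ℝ :=
  Real.sqrt (∫ x, (g x) ^ 2)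

/-- The `C¹` norm of `W` on the ball `B(0,R₀)`:
`sup_{B(0,R₀)} |W| + sup_{B(0,R₀)} |∇W|`. -/
noncomputable def eC1Norm {n : ℕ} (W : EuclideanSpace ℝ (Fin n) → ℝ) (R₀ : ℝ) : ℝ :=
  sSup ((fun x => |W x|) '' ball (0 : EuclideanSpace ℝ (Fin n)) R₀) +
    sSup ((fun x => ‖gradient W x‖) '' ball (0 : EuclideanSpace ℝ (Fin n)) R₀)

section Support

variable {n : ℕ} {K : Set (EuclideanSpace ℝ (Fin n))}

theorem eventually_eq_zero_of_notMem {F : Type*} [Zero F] {f : EuclideanSpace ℝ (Fin n) → F}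
    (hK : IsCompact K) (hf : ∀ x ∉ K, f x = 0) {x : EuclideanSpace ℝ (Fin n)} (hx : x ∉ K) :
    f =ᶠ[nhds x] fun _ => 0 := by
  filter_upwards [hK.isClosed.isOpen_compl.mem_nhds hx] with y hy using hf y hy

theorem fderiv_eq_zero_of_notMem {F : Type*} [NormedAddCommGroup F] [NormedSpace ℝ F]
    {f : EuclideanSpace ℝ (Fin n) → F}
    (hK : IsCompact K) (hf : ∀ x ∉ K, f x = 0) {x : EuclideanSpace ℝ (Fin n)} (hx : x ∉ K) :
    fderiv ℝ f x = 0 := by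
  rw [(eventually_eq_zero_of_notMem hK hf hx).fderiv_eq]
  simp

theorem eLap_eq_zero_of_notMem {f : EuclideanSpace ℝ (Fin n) → ℝ}
    (hK : IsCompact K) (hf : ∀ x ∉ K, f x = 0) {x : EuclideanSpace ℝ (Fin n)} (hx : x ∉ K) :
    eLap f x = 0 := by
  unfold eLap
  refine Finset.sum_eq_zero fun i _ => ?_
  rw [fderiv_eq_zero_of_notMem hK (fun y hy => ?_) hx]
  · simp
  · rw [fderiv_eq_zero_of_notMem hK hf hy]; simp

theorem contDiff_of_contDiffAt_ne_zero {F : Type*} [NormedAddCommGroup F] [NormedSpace ℝ F]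
    {f : EuclideanSpace ℝ (Fin n) → F} {k : WithTop ℕ∞}
    (hK : IsCompact K) (h0 : (0 : EuclideanSpace ℝ (Fin n)) ∉ K) (hf : ∀ x ∉ K, f x = 0)
    (hd : ∀ x ≠ 0, ContDiffAt ℝ k f x) : ContDiff ℝ k f := by
  rw [contDiff_iff_contDiffAt]
  intro x
  by_cases hx : x = 0
  · subst hx
    exact contDiffAt_const.congr_of_eventuallyEq (eventually_eq_zero_of_notMem hK hf h0)
  · exact hd x hx

theorem integrable_of_continuousAt_ne_zero {f : EuclideanSpace ℝ (Fin n) → ℝ}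
    (hK : IsCompact K) (h0 : (0 : EuclideanSpace ℝ (Fin n)) ∉ K) (hf : ∀ x ∉ K, f x = 0)
    (hd : ∀ x ≠ 0, ContinuousAt f x) : Integrable f := by
  have hc : Continuous f := by
    rw [continuous_iff_continuousAt]
    intro x
    by_cases hx : x = 0
    · subst hx
      exact continuousAt_const.congr (eventually_eq_zero_of_notMem hK hf h0).symm
    · exact hd x hx
  exact hc.integrable_of_hasCompactSupport (HasCompactSupport.intro hK hf)

theorem integral_fderiv_apply_eq_zero {f : EuclideanSpace ℝ (Fin n) → ℝ}
    (hf : ContDiff ℝ 1 f) (hs : HasCompactSupport f) (a : EuclideanSpace ℝ (Fin n)) :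
    ∫ x, fderiv ℝ f x a = 0 := by
  have hc : Continuous fun x => fderiv ℝ f x a :=
    (hf.continuous_fderiv one_ne_zero).clm_apply continuous_const
  have hi : Integrable fun x => fderiv ℝ f x a :=
    hc.integrable_of_hasCompactSupport (hs.fderiv_apply ℝ a)
  have := integral_mul_fderiv_eq_neg_fderiv_mul_of_integrable
    (μ := (volume : Measure (EuclideanSpace ℝ (Fin n))))
    (f := fun _ => (1 : ℝ)) (g := f) (v := a) (by simp)
    (by simpa using hi) (by simpa using hf.continuous.integrable_of_hasCompactSupport hs)
    (fun x _ => differentiableAt_const _)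
    (fun x _ => hf.differentiable one_ne_zero x)
  simpa using this

theorem integral_divergence_eq_zero {F : Fin n → EuclideanSpace ℝ (Fin n) → ℝ}
    (hK : IsCompact K) (h0 : (0 : EuclideanSpace ℝ (Fin n)) ∉ K) (hF : ∀ i, ∀ x ∉ K, F i x = 0)
    (hd : ∀ i, ∀ x ≠ 0, ContDiffAt ℝ 1 (F i) x) :
    Integrable (fun x => ∑ i, fderiv ℝ (F i) x (EuclideanSpace.single i 1)) ∧
    ∫ x, ∑ i, fderiv ℝ (F i) x (EuclideanSpace.single i 1) = 0 := by
  have hC : ∀ i, ContDiff ℝ 1 (F i) := fun i =>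
    contDiff_of_contDiffAt_ne_zero hK h0 (hF i) (hd i)
  have hS : ∀ i, HasCompactSupport (F i) := fun i => HasCompactSupport.intro hK (hF i)
  have hI : ∀ i ∈ (Finset.univ : Finset (Fin n)),
      Integrable fun x => fderiv ℝ (F i) x (EuclideanSpace.single i 1) := fun i _ =>
    (((hC i).continuous_fderiv one_ne_zero).clm_apply
      continuous_const).integrable_of_hasCompactSupport ((hS i).fderiv_apply ℝ _)
  refine ⟨integrable_finsetSum _ hI, ?_⟩
  rw [integral_finsetSum _ hI]
  exact Finset.sum_eq_zero fun i _ => integral_fderiv_apply_eq_zero (hC i) (hS i) _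

end Support

section Radial

variable {n : ℕ}

theorem clm_apply_eq_sum (L : EuclideanSpace ℝ (Fin n) →L[ℝ] ℝ) (x : EuclideanSpace ℝ (Fin n)) :
    L x = ∑ i, x i * L (EuclideanSpace.single i 1) := by
  conv_lhs => rw [← (EuclideanSpace.basisFun (Fin n) ℝ).sum_repr x]
  simp [map_sum]

theorem norm_gradient_sq (f : EuclideanSpace ℝ (Fin n) → ℝ) (x : EuclideanSpace ℝ (Fin n)) :
    ‖gradient f x‖ ^ 2 = ∑ i, (fderiv ℝ f x (EuclideanSpace.single i 1)) ^ 2 := by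
  rw [EuclideanSpace.norm_sq_eq]
  refine Finset.sum_congr rfl fun i _ => ?_
  rw [← toDual_gradient (𝕜 := ℝ) (f := f), InnerProductSpace.toDual_apply_apply,
    EuclideanSpace.inner_single_right]
  simp

theorem hasFDerivAt_norm_rpow_of_ne_zero {x : EuclideanSpace ℝ (Fin n)} (hx : x ≠ 0) (p : ℝ) :
    HasFDerivAt (fun y : EuclideanSpace ℝ (Fin n) => ‖y‖ ^ p)
      ((p * ‖x‖ ^ p / ‖x‖ ^ 2) • innerSL ℝ x) x := by
  have hpos : 0 < ‖x‖ := norm_pos_iff.2 hx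
  have h := (hasStrictFDerivAt_norm_sq x).hasFDerivAt.rpow_const (p := p / 2)
    (Or.inl (by positivity))
  have e : (fun y : EuclideanSpace ℝ (Fin n) => (‖y‖ ^ 2) ^ (p / 2)) = fun y => ‖y‖ ^ p := by
    funext y
    rw [← Real.rpow_natCast, ← Real.rpow_mul (norm_nonneg _)]
    congr 1; push_cast; ring
  rw [e] at h
  convert! h using 1
  rw [Real.rpow_sub (by positivity), Real.rpow_one, congrFun e x]
  ext y
  simp
  ring

theorem contDiffAt_norm_rpow {x : EuclideanSpace ℝ (Fin n)} (hx : x ≠ 0) (p : ℝ)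
    (k : WithTop ℕ∞) : ContDiffAt ℝ k (fun y : EuclideanSpace ℝ (Fin n) => ‖y‖ ^ p) x :=
  (contDiffAt_norm ℝ hx).rpow_const_of_ne (norm_ne_zero_iff.2 hx)

theorem hasFDerivAt_log_norm {x : EuclideanSpace ℝ (Fin n)} (hx : x ≠ 0) :
    HasFDerivAt (fun y : EuclideanSpace ℝ (Fin n) => Real.log ‖y‖)
      ((1 / ‖x‖ ^ 2) • innerSL ℝ x) x := by
  have h := (hasFDerivAt_norm_rpow_of_ne_zero hx 1).log (by simpa using hx)
  simp only [Real.rpow_one] at h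
  convert! h using 1
  have : ‖x‖ ≠ 0 := norm_ne_zero_iff.2 hx
  ext y
  simp
  field_simp

end Radial

section Flux

variable {n : ℕ}

theorem sum_fderiv_flux {v w g : EuclideanSpace ℝ (Fin n) → ℝ} (hv : ContDiff ℝ 2 v)
    {x : EuclideanSpace ℝ (Fin n)} (hx : x ≠ 0)
    (hw : DifferentiableAt ℝ w x) (hg : DifferentiableAt ℝ g x) :
    ∑ i, fderiv ℝ (fun y => ‖y‖ ^ (2 - n : ℝ) * w y * fderiv ℝ v y (EuclideanSpace.single i 1)
        + ‖y‖ ^ (-n : ℝ) * g y * y i) x (EuclideanSpace.single i 1) =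
      ‖x‖ ^ (-n : ℝ) * (‖x‖ ^ 2 * ∑ i, fderiv ℝ w x (EuclideanSpace.single i 1) *
          fderiv ℝ v x (EuclideanSpace.single i 1)
        + w x * (‖x‖ ^ 2 * eLap v x - (n - 2) * fderiv ℝ v x x) + fderiv ℝ g x x) := by
  have hpos : 0 < ‖x‖ := norm_pos_iff.2 hx
  have hv' : DifferentiableAt ℝ (fderiv ℝ v) x :=
    (hv.fderiv_right (m := 1) (by norm_num)).differentiable one_ne_zero x
  have hp : ‖x‖ ^ (2 - n : ℝ) = ‖x‖ ^ (-n : ℝ) * ‖x‖ ^ 2 := by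
    rw [← Real.rpow_natCast, ← Real.rpow_add hpos]; congr 1; push_cast; ring
  have key : ∀ i : Fin n,
      fderiv ℝ (fun y => ‖y‖ ^ (2 - n : ℝ) * w y * fderiv ℝ v y (EuclideanSpace.single i 1)
        + ‖y‖ ^ (-n : ℝ) * g y * y i) x (EuclideanSpace.single i 1) =
      ‖x‖ ^ (-n : ℝ) * (‖x‖ ^ 2 * (fderiv ℝ w x (EuclideanSpace.single i 1) *
          fderiv ℝ v x (EuclideanSpace.single i 1)))
      + ‖x‖ ^ (-n : ℝ) * w x * ((2 - n) * (x i * fderiv ℝ v x (EuclideanSpace.single i 1))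
        + ‖x‖ ^ 2 * fderiv ℝ (fun y => fderiv ℝ v y (EuclideanSpace.single i 1)) x
            (EuclideanSpace.single i 1))
      + ‖x‖ ^ (-n : ℝ) * (x i * fderiv ℝ g x (EuclideanSpace.single i 1))
      + ‖x‖ ^ (-n : ℝ) * g x * (1 - n * (x i ^ 2 / ‖x‖ ^ 2)) := by
    intro i
    have h1 := ((hasFDerivAt_norm_rpow_of_ne_zero hx (2 - n : ℝ)).mul hw.hasFDerivAt).mul
      (hv'.clm_apply (differentiableAt_const (EuclideanSpace.single i (1 : ℝ)))).hasFDerivAt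
    have h2 := ((hasFDerivAt_norm_rpow_of_ne_zero hx (-n : ℝ)).mul hg.hasFDerivAt).mul
      (EuclideanSpace.proj (𝕜 := ℝ) i).hasFDerivAt
    have h3 := (h1.add h2).fderiv
    have h4 := congrArg (fun L => L (EuclideanSpace.single i (1 : ℝ))) h3
    refine Eq.trans ?_ (h4.trans ?_)
    · rfl
    · simp [EuclideanSpace.inner_single_right, hp]
      field_simp
      ring
  rw [Finset.sum_congr rfl fun i _ => key i]
  simp only [Finset.sum_add_distrib, ← Finset.mul_sum, ← Finset.sum_div,
    Finset.sum_sub_distrib, ← clm_apply_eq_sum]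
  have hn : ∑ i, x i ^ 2 = ‖x‖ ^ 2 := by
    rw [EuclideanSpace.norm_sq_eq]; simp
  rw [hn]
  simp only [eLap, Finset.sum_const, Finset.card_univ, Fintype.card_fin, nsmul_eq_mul]
  field_simp
  ring

theorem hasFDerivAt_carlemanRadial {x : EuclideanSpace ℝ (Fin n)} (hx : x ≠ 0) (ε τ : ℝ) :
    HasFDerivAt (fun y : EuclideanSpace ℝ (Fin n) => τ * (1 - ε * ‖y‖ ^ ε) - 1)
      ((-(τ * ε ^ 2 * ‖x‖ ^ ε) / ‖x‖ ^ 2) • innerSL ℝ x) x := by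
  have h := ((((hasFDerivAt_norm_rpow_of_ne_zero hx ε).const_mul ε).const_sub 1).const_mul
    τ).sub_const 1
  convert! h using 1
  ext y
  simp
  ring

theorem fderiv_fderiv_symm {v : EuclideanSpace ℝ (Fin n) → ℝ} (hv : ContDiff ℝ 2 v)
    (x a b : EuclideanSpace ℝ (Fin n)) :
    fderiv ℝ (fderiv ℝ v) x a b = fderiv ℝ (fderiv ℝ v) x b a :=
  (hv.contDiffAt.isSymmSndFDerivAt (by simp)).eq a b

theorem hasFDerivAt_euler {v : EuclideanSpace ℝ (Fin n) → ℝ} (hv : ContDiff ℝ 2 v)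
    (x : EuclideanSpace ℝ (Fin n)) :
    HasFDerivAt (fun y => fderiv ℝ v y y)
      (fderiv ℝ v x + fderiv ℝ (fderiv ℝ v) x x) x := by
  have hv' : DifferentiableAt ℝ (fderiv ℝ v) x :=
    (hv.fderiv_right (m := 1) (by norm_num)).differentiable one_ne_zero x
  have h := hv'.hasFDerivAt.clm_apply (hasFDerivAt_id x)
  convert! h using 1
  ext y
  simp [fderiv_fderiv_symm hv x y x]

theorem sum_fderiv_multiplier {v : EuclideanSpace ℝ (Fin n) → ℝ} (hv : ContDiff ℝ 2 v)
    {x : EuclideanSpace ℝ (Fin n)} (hx : x ≠ 0) (ε τ : ℝ) :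
    DifferentiableAt ℝ (fun y => 4 * ((τ * (1 - ε * ‖y‖ ^ ε) - 1) * fderiv ℝ v y y)
      - 4 * τ * ε ^ 2 * (‖y‖ ^ ε * v y)) x ∧
    ‖x‖ ^ 2 * ∑ i, fderiv ℝ (fun y => 4 * ((τ * (1 - ε * ‖y‖ ^ ε) - 1) * fderiv ℝ v y y)
      - 4 * τ * ε ^ 2 * (‖y‖ ^ ε * v y)) x (EuclideanSpace.single i 1) *
          fderiv ℝ v x (EuclideanSpace.single i 1) =
      4 * (-(τ * ε ^ 2 * ‖x‖ ^ ε)) * fderiv ℝ v x x ^ 2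
      + 4 * (τ * (1 - ε * ‖x‖ ^ ε) - 1) *
        (‖x‖ ^ 2 * ∑ i, fderiv ℝ v x (EuclideanSpace.single i 1) ^ 2
          + ‖x‖ ^ 2 * ∑ i, fderiv ℝ v x (EuclideanSpace.single i 1) *
              fderiv ℝ (fderiv ℝ v) x x (EuclideanSpace.single i 1))
      - 4 * τ * ε ^ 3 * ‖x‖ ^ ε * v x * fderiv ℝ v x x
      - 4 * τ * ε ^ 2 * ‖x‖ ^ ε * (‖x‖ ^ 2 * ∑ i, fderiv ℝ v x (EuclideanSpace.single i 1) ^ 2) := by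
  have hpos : 0 < ‖x‖ := norm_pos_iff.2 hx
  have h := ((((hasFDerivAt_carlemanRadial hx ε τ).mul (hasFDerivAt_euler hv x)).const_mul 4).sub
    (((hasFDerivAt_norm_rpow_of_ne_zero hx ε).mul
      (hv.differentiable two_ne_zero x).hasFDerivAt).const_mul (4 * τ * ε ^ 2)))
  refine ⟨h.differentiableAt, ?_⟩
  have h' := h.fderiv
  simp only [Pi.sub_def, Pi.mul_def] at h'
  rw [h', Finset.mul_sum]
  rw [clm_apply_eq_sum (fderiv ℝ v x) x]
  set p := ∑ i, x i * fderiv ℝ v x (EuclideanSpace.single i 1) with hp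
  have key : ∀ i : Fin n, ‖x‖ ^ 2 * ((4 • ((τ * (1 - ε * ‖x‖ ^ ε) - 1) •
        (fderiv ℝ v x + fderiv ℝ (fderiv ℝ v) x x)
          + p • (-(τ * ε ^ 2 * ‖x‖ ^ ε) / ‖x‖ ^ 2) • innerSL ℝ x)
        - (4 * τ * ε ^ 2) • (‖x‖ ^ ε • fderiv ℝ v x
          + v x • (ε * ‖x‖ ^ ε / ‖x‖ ^ 2) • innerSL ℝ x)) (EuclideanSpace.single i 1) *
        fderiv ℝ v x (EuclideanSpace.single i 1)) =
      (4 * (-(τ * ε ^ 2 * ‖x‖ ^ ε)) * p - 4 * τ * ε ^ 3 * ‖x‖ ^ ε * v x) *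
        (x i * fderiv ℝ v x (EuclideanSpace.single i 1)) +
      (4 * (τ * (1 - ε * ‖x‖ ^ ε) - 1) * ‖x‖ ^ 2 - 4 * τ * ε ^ 2 * ‖x‖ ^ ε * ‖x‖ ^ 2) *
        fderiv ℝ v x (EuclideanSpace.single i 1) ^ 2 +
      4 * (τ * (1 - ε * ‖x‖ ^ ε) - 1) * ‖x‖ ^ 2 * (fderiv ℝ v x (EuclideanSpace.single i 1) *
              fderiv ℝ (fderiv ℝ v) x x (EuclideanSpace.single i 1)) := by
    intro i
    simp [EuclideanSpace.inner_single_right]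
    field_simp
    ring
  refine (Finset.sum_congr rfl fun i _ => ?_).trans
    ((Finset.sum_congr rfl fun i _ => key i).trans ?_)
  · rw [hp, ← clm_apply_eq_sum]
    simp
  simp only [Finset.sum_add_distrib, ← Finset.mul_sum]
  rw [← hp]
  ring

theorem fderiv_euler_remainder {v W : EuclideanSpace ℝ (Fin n) → ℝ} (hv : ContDiff ℝ 2 v)
    (hW : ContDiff ℝ 1 W) {x : EuclideanSpace ℝ (Fin n)} (hx : x ≠ 0) (ε τ ν : ℝ) :
    DifferentiableAt ℝ (fun y => -2 * ((τ * (1 - ε * ‖y‖ ^ ε) - 1) *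
        (‖y‖ ^ 2 * ∑ i, fderiv ℝ v y (EuclideanSpace.single i 1) ^ 2))
      + (2 * ((τ * (1 - ε * ‖y‖ ^ ε) - 1) * ((τ * (1 - ε * ‖y‖ ^ ε) - 1) ^ 2
          - τ * ε ^ 2 * ‖y‖ ^ ε - ν ^ 2 + ‖y‖ ^ 2 * W y))
        + 2 * τ * ε ^ 3 * ‖y‖ ^ ε) * v y ^ 2) x ∧
    fderiv ℝ (fun y => -2 * ((τ * (1 - ε * ‖y‖ ^ ε) - 1) *
        (‖y‖ ^ 2 * ∑ i, fderiv ℝ v y (EuclideanSpace.single i 1) ^ 2))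
      + (2 * ((τ * (1 - ε * ‖y‖ ^ ε) - 1) * ((τ * (1 - ε * ‖y‖ ^ ε) - 1) ^ 2
          - τ * ε ^ 2 * ‖y‖ ^ ε - ν ^ 2 + ‖y‖ ^ 2 * W y))
        + 2 * τ * ε ^ 3 * ‖y‖ ^ ε) * v y ^ 2) x x =
    2 * τ * ε ^ 2 * ‖x‖ ^ ε * (‖x‖ ^ 2 * ∑ i, fderiv ℝ v x (EuclideanSpace.single i 1) ^ 2)
    - 4 * (τ * (1 - ε * ‖x‖ ^ ε) - 1) *
        (‖x‖ ^ 2 * ∑ i, fderiv ℝ v x (EuclideanSpace.single i 1) ^ 2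
          + ‖x‖ ^ 2 * ∑ i, fderiv ℝ v x (EuclideanSpace.single i 1) *
              fderiv ℝ (fderiv ℝ v) x x (EuclideanSpace.single i 1))
    + (2 * (-(τ * ε ^ 2 * ‖x‖ ^ ε) * ((τ * (1 - ε * ‖x‖ ^ ε) - 1) ^ 2
          - τ * ε ^ 2 * ‖x‖ ^ ε - ν ^ 2 + ‖x‖ ^ 2 * W x)
        + (τ * (1 - ε * ‖x‖ ^ ε) - 1) * (-2 * (τ * (1 - ε * ‖x‖ ^ ε) - 1) * (τ * ε ^ 2 * ‖x‖ ^ ε)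
          - τ * ε ^ 3 * ‖x‖ ^ ε + 2 * ‖x‖ ^ 2 * W x + ‖x‖ ^ 2 * fderiv ℝ W x x))
      + 2 * τ * ε ^ 4 * ‖x‖ ^ ε) * v x ^ 2
    + (2 * ((τ * (1 - ε * ‖x‖ ^ ε) - 1) * ((τ * (1 - ε * ‖x‖ ^ ε) - 1) ^ 2
          - τ * ε ^ 2 * ‖x‖ ^ ε - ν ^ 2 + ‖x‖ ^ 2 * W x))
        + 2 * τ * ε ^ 3 * ‖x‖ ^ ε) * (2 * v x * fderiv ℝ v x x) := by
  have hpos : 0 < ‖x‖ := norm_pos_iff.2 hx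
  have hv' : DifferentiableAt ℝ (fderiv ℝ v) x :=
    (hv.fderiv_right (m := 1) (by norm_num)).differentiable one_ne_zero x
  have hs := hasFDerivAt_carlemanRadial hx ε τ
  have hN := hasFDerivAt_norm_rpow_of_ne_zero hx ε
  have hρ := (hasStrictFDerivAt_norm_sq x).hasFDerivAt
  have hvd := (hv.differentiable two_ne_zero x).hasFDerivAt
  have hWd := (hW.differentiable one_ne_zero x).hasFDerivAt
  have hS : HasFDerivAt (fun y => ∑ i, fderiv ℝ v y (EuclideanSpace.single i 1) ^ 2) _ x :=
    HasFDerivAt.fun_sum (u := Finset.univ) fun i _ =>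
      ((hv'.hasFDerivAt.clm_apply (hasFDerivAt_const (EuclideanSpace.single i (1 : ℝ)) x)).pow 2)
  have hc := (((hs.pow 2).sub (hN.const_mul (τ * ε ^ 2))).sub_const (ν ^ 2)).add (hρ.mul hWd)
  have h := ((hs.mul (hρ.mul hS)).const_mul (-2)).add
    ((((hs.mul hc).const_mul 2).add (hN.const_mul (2 * τ * ε ^ 3))).mul (hvd.pow 2))
  refine ⟨h.differentiableAt, ?_⟩
  refine (congrArg (fun L => L x) h.fderiv).trans ?_
  simp [← Finset.mul_sum, mul_assoc]
  field_simp
  ring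

end Flux

section Algebra

/-- The quadratic form in `v`, its Euler derivative `p` and its scaled squared gradient `G`
that remains of the squared conjugated operator after removing exact divergences. -/
noncomputable def carlemanForm (ε τ N ρ W V ν G p v : ℝ) : ℝ :=
  4 * (τ * (1 - ε * N) - 1) ^ 2 * p ^ 2 + 4 * τ * ε ^ 2 * N * p ^ 2
    + 2 * τ * ε ^ 2 * N * G
    + (- (2 * τ * ε ^ 2 * N) ^ 2
      - 4 * τ * ε ^ 2 * N *
        ((τ * (1 - ε * N) - 1) ^ 2 - τ * ε ^ 2 * N - ν ^ 2 + ρ * W)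
      - 2 * (-(τ * ε ^ 2 * N) * ((τ * (1 - ε * N) - 1) ^ 2 - τ * ε ^ 2 * N - ν ^ 2 + ρ * W)
        + (τ * (1 - ε * N) - 1) * (-2 * (τ * (1 - ε * N) - 1) * (τ * ε ^ 2 * N)
          - τ * ε ^ 3 * N + 2 * ρ * W + ρ * V))
      - 2 * τ * ε ^ 4 * N) * v ^ 2

theorem carleman_quadratic_bound {ε τ N ρ W V ν G p v M β : ℝ} (hε0 : 0 < ε) (hε1 : ε < 1)
    (hβ : β = (1 - ε) / 2) (hN0 : 0 < N) (hN1 : N ≤ 1) (hρ0 : 0 ≤ ρ) (hρN : ρ ≤ N)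
    (hW : |W| ≤ M) (hV : |V| ≤ M) (hM : 36 * M ≤ (ε * β * τ) ^ 2) (hτ : 16 ≤ β ^ 2 * τ)
    (hG : 0 ≤ G) :
    N * (3 * τ ^ 3 * v ^ 2 + 2 * τ * G) ≤ 3 / (β ^ 2 * ε ^ 2) *
      carlemanForm ε τ N ρ W V ν G p v := by
  unfold carlemanForm
  have hβ0 : 0 < β := by rw [hβ]; linarith
  have hβ1 : β < 1 := by rw [hβ]; linarith
  have hε2 : ε ^ 2 ≤ 1 := pow_le_one₀ hε0.le hε1.le
  have hβ2 : β ^ 2 ≤ 1 := pow_le_one₀ hβ0.le hβ1.le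
  have hτ0 : 0 < τ := by
    by_contra h
    nlinarith [sq_nonneg β]
  have hM0 : 0 ≤ M := (abs_nonneg _).trans hW
  have hβτ : 16 ≤ β * τ := by nlinarith
  have hτ1 : 1 ≤ τ := by nlinarith
  set σ := τ * (1 - ε * N) - 1 with hσ
  have hσl : β * τ ≤ σ := by
    have : ε * N ≤ ε := by nlinarith
    have h2 : τ * (2 * β) ≤ τ * (1 - ε * N) := by
      apply mul_le_mul_of_nonneg_left _ hτ0.le
      rw [hβ]; linarith
    linarith
  have hσu : σ ≤ τ := by
    have : 0 ≤ τ * (ε * N) := by positivity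
    linarith
  have hσ0 : 0 < σ := by nlinarith
  set q := ε ^ 2 * N with hq
  have hq0 : 0 < q := by positivity
  have hq1 : q ≤ 1 := by
    rw [hq]
    nlinarith
  have t1 : 2 * τ * q * (β * τ) ^ 2 ≤ 2 * τ * q * σ ^ 2 := by gcongr
  have t2 : 2 * τ ^ 2 * q * q ≤ 2 * τ ^ 2 * q * 1 := by gcongr
  have t3 : 2 * τ * ε ^ 2 * q ≤ 2 * τ ^ 2 * q := by
    have h1 : τ * ε ^ 2 ≤ τ * τ := by
      gcongr
      exact hε2.trans hτ1
    have h2 : 2 * q * (τ * ε ^ 2) ≤ 2 * q * (τ * τ) := by gcongr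
    linear_combination h2
  have hρ1 : ρ ≤ 1 := hρN.trans hN1
  have t4 : 2 * τ * q * (ρ * W) ≤ 2 * τ * q * M := by
    have : ρ * W ≤ 1 * M :=
      (mul_le_mul_of_nonneg_left ((le_abs_self W).trans hW) hρ0).trans (by gcongr)
    gcongr
    linarith
  have t5 : 2 * σ * (ρ * (2 * W + V)) ≤ 2 * τ * (N * (3 * M)) := by
    have h1 : 2 * W + V ≤ 3 * M := by linarith [le_abs_self W, le_abs_self V]
    have h2 : ρ * (2 * W + V) ≤ N * (3 * M) :=
      (mul_le_mul_of_nonneg_left h1 hρ0).trans (by gcongr)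
    calc 2 * σ * (ρ * (2 * W + V)) ≤ 2 * σ * (N * (3 * M)) := by gcongr
      _ ≤ _ := by gcongr
  have t6 : 2 * τ * (N * (3 * M)) ≤ β ^ 2 * τ ^ 3 * q / 6 := by
    have : τ * N * (36 * M) ≤ τ * N * (ε * β * τ) ^ 2 := by gcongr
    rw [hq]
    linear_combination this / 6
  have t7 : 2 * τ * q * M ≤ β ^ 2 * τ ^ 3 * q / 6 := by
    have : τ * q * (36 * M) ≤ τ * q * (ε * β * τ) ^ 2 := by gcongr
    have h2 : τ * q * (ε * β * τ) ^ 2 ≤ τ * q * (1 * (β * τ) ^ 2) := by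
      have : (ε * β * τ) ^ 2 = ε ^ 2 * (β * τ) ^ 2 := by ring
      rw [this]
      gcongr
    have h3 : 0 ≤ β ^ 2 * τ ^ 3 * q := by positivity
    linear_combination this / 18 + h2 / 18 + h3 / 9
  have t8 : 4 * τ ^ 2 * q ≤ β ^ 2 * τ ^ 3 * q / 4 := by
    have : τ ^ 2 * q * 16 ≤ τ ^ 2 * q * (β ^ 2 * τ) := by gcongr
    linear_combination this / 4
  have t9 : 0 ≤ 2 * σ * τ * ε * q + 2 * ν ^ 2 * τ * q := by positivity
  have h3 : 0 ≤ β ^ 2 * τ ^ 3 * q := by positivity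
  have hcoef : β ^ 2 * τ ^ 3 * q ≤ (- (2 * τ * ε ^ 2 * N) ^ 2
          - 4 * τ * ε ^ 2 * N * (σ ^ 2 - τ * ε ^ 2 * N - ν ^ 2 + ρ * W)
          - 2 * (-(τ * ε ^ 2 * N) * (σ ^ 2 - τ * ε ^ 2 * N - ν ^ 2 + ρ * W)
            + σ * (-2 * σ * (τ * ε ^ 2 * N)
              - τ * ε ^ 3 * N + 2 * ρ * W + ρ * V))
          - 2 * τ * ε ^ 4 * N) := by
    rw [hq] at t1 t2 t3 t4 t6 t7 t8 t9 h3 ⊢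
    linear_combination t1 + t2 + t3 + t4 + t5 + t6 + t7 + t8 + t9 + 5 / 12 * h3
  have hfin := mul_le_mul_of_nonneg_right hcoef (sq_nonneg v)
  have hp : 0 ≤ 4 * σ ^ 2 * p ^ 2 + 4 * τ * ε ^ 2 * N * p ^ 2 := by positivity
  rw [div_mul_eq_mul_div, le_div_iff₀ (by positivity)]
  have hG' : 0 ≤ τ * ε ^ 2 * N * G * (3 - β ^ 2) := by
    have : 0 ≤ 3 - β ^ 2 := by linarith
    positivity
  rw [hq] at hfin
  linear_combination 3 * hfin + 3 * hp + 2 * hG'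

end Algebra

section Conjugation

variable {n : ℕ}

/-- The weight `e^{τφ(x)} |x|^{n/2}` with `φ(x) = -log|x| + |x|^ε`. -/
noncomputable def carlemanWeight (ε τ : ℝ) (x : EuclideanSpace ℝ (Fin n)) : ℝ :=
  Real.exp (τ * (-Real.log ‖x‖ + ‖x‖ ^ ε)) * ‖x‖ ^ (n / 2 : ℝ)

theorem hasFDerivAt_carlemanWeight {x : EuclideanSpace ℝ (Fin n)} (hx : x ≠ 0) (ε τ : ℝ) :
    HasFDerivAt (carlemanWeight ε τ)
      ((-(carlemanWeight ε τ x * ((τ * (1 - ε * ‖x‖ ^ ε) - n / 2) * ‖x‖ ^ (-2 : ℝ)))) •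
        innerSL ℝ x) x := by
  have hpos : 0 < ‖x‖ := norm_pos_iff.2 hx
  have h2 : ‖x‖ ^ (-2 : ℝ) = (‖x‖ ^ 2)⁻¹ := by
    rw [Real.rpow_neg hpos.le]; norm_num
  have h := ((((hasFDerivAt_log_norm hx).neg.add
    (hasFDerivAt_norm_rpow_of_ne_zero hx ε)).const_mul τ).exp).mul
      (hasFDerivAt_norm_rpow_of_ne_zero hx (n / 2 : ℝ))
  convert! h using 1
  rw [h2]
  ext y
  simp [carlemanWeight]
  field_simp
  ring

theorem contDiffAt_carlemanWeight {x : EuclideanSpace ℝ (Fin n)} (hx : x ≠ 0) (ε τ : ℝ)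
    (k : WithTop ℕ∞) : ContDiffAt ℝ k (carlemanWeight ε τ) x := by
  have hl : ContDiffAt ℝ k (fun y : EuclideanSpace ℝ (Fin n) => Real.log ‖y‖) x :=
    (contDiffAt_norm ℝ hx).log (norm_ne_zero_iff.2 hx)
  exact ((contDiffAt_const.mul (hl.neg.add (contDiffAt_norm_rpow hx ε k))).exp).mul
    (contDiffAt_norm_rpow hx _ k)

theorem fderiv_carlemanWeight_mul {u : EuclideanSpace ℝ (Fin n) → ℝ}
    {x : EuclideanSpace ℝ (Fin n)} (hx : x ≠ 0) (hu : DifferentiableAt ℝ u x) (ε τ : ℝ)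
    (a : EuclideanSpace ℝ (Fin n)) :
    fderiv ℝ (fun y => carlemanWeight ε τ y * u y) x a = carlemanWeight ε τ x *
      (fderiv ℝ u x a - (τ * (1 - ε * ‖x‖ ^ ε) - n / 2) * ‖x‖ ^ (-2 : ℝ) * inner ℝ x a * u x) := by
  have h := ((hasFDerivAt_carlemanWeight hx ε τ).mul hu.hasFDerivAt).fderiv
  refine (congrArg (fun L => L a) h).trans ?_
  simp
  ring

theorem carleman_conjugation {u : EuclideanSpace ℝ (Fin n) → ℝ} (hu : ContDiff ℝ 2 u)
    {x : EuclideanSpace ℝ (Fin n)} (hx : x ≠ 0) (ε τ W : ℝ) :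
    ‖x‖ ^ 2 * eLap (fun y => carlemanWeight ε τ y * u y) x
      - (n - 2) * fderiv ℝ (fun y => carlemanWeight ε τ y * u y) x x
      + 2 * (τ * (1 - ε * ‖x‖ ^ ε) - 1) * fderiv ℝ (fun y => carlemanWeight ε τ y * u y) x x
      + ((τ * (1 - ε * ‖x‖ ^ ε) - 1) ^ 2 - τ * ε ^ 2 * ‖x‖ ^ ε - ((n - 2) / 2) ^ 2 + ‖x‖ ^ 2 * W) *
        (carlemanWeight ε τ x * u x) =
    carlemanWeight ε τ x * (‖x‖ ^ 2 * (eLap u x + W * u x)) := by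
  have hpos : 0 < ‖x‖ := norm_pos_iff.2 hx
  have h2 : ‖x‖ ^ (-2 : ℝ) = (‖x‖ ^ 2)⁻¹ := by
    rw [Real.rpow_neg hpos.le]; norm_num
  have hud := hu.differentiable two_ne_zero
  have hu' : DifferentiableAt ℝ (fderiv ℝ u) x :=
    (hu.fderiv_right (m := 1) (by norm_num)).differentiable one_ne_zero x
  have hs : HasFDerivAt (fun y : EuclideanSpace ℝ (Fin n) =>
      (τ * (1 - ε * ‖y‖ ^ ε) - n / 2) * ‖y‖ ^ (-2 : ℝ)) _ x :=
    ((((hasFDerivAt_norm_rpow_of_ne_zero hx ε).const_mul ε).const_sub 1).const_mul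
      τ).sub_const (n / 2 : ℝ) |>.mul (hasFDerivAt_norm_rpow_of_ne_zero hx (-2 : ℝ))
  set s := τ * (1 - ε * ‖x‖ ^ ε) - n / 2 with hsdef
  set ω := carlemanWeight ε τ x with hω
  have key : ∀ i : Fin n,
      fderiv ℝ (fun y => fderiv ℝ (fun z => carlemanWeight ε τ z * u z) y
        (EuclideanSpace.single i 1)) x (EuclideanSpace.single i 1) =
      ω * fderiv ℝ (fun y => fderiv ℝ u y (EuclideanSpace.single i 1)) x
        (EuclideanSpace.single i 1)
      - 2 * ω * (s / ‖x‖ ^ 2) * (x i * fderiv ℝ u x (EuclideanSpace.single i 1))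
      + ω * u x / ‖x‖ ^ 4 * (s ^ 2 + τ * ε ^ 2 * ‖x‖ ^ ε + 2 * s) * x i ^ 2
      - ω * u x * s / ‖x‖ ^ 2 := by
    intro i
    have hev : (fun y => fderiv ℝ (fun z => carlemanWeight ε τ z * u z) y
        (EuclideanSpace.single i 1)) =ᶠ[nhds x] fun y => carlemanWeight ε τ y *
        (fderiv ℝ u y (EuclideanSpace.single i 1) -
          (τ * (1 - ε * ‖y‖ ^ ε) - n / 2) * ‖y‖ ^ (-2 : ℝ) * y i * u y) := by
      filter_upwards [isOpen_ne.mem_nhds hx] with y hy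
      rw [fderiv_carlemanWeight_mul hy (hud y), EuclideanSpace.inner_single_right]
      simp
    rw [hev.fderiv_eq]
    have h := (hasFDerivAt_carlemanWeight hx ε τ).mul
      ((hu'.clm_apply (differentiableAt_const (EuclideanSpace.single i (1 : ℝ)))).hasFDerivAt.sub
        ((hs.mul (EuclideanSpace.proj (𝕜 := ℝ) i).hasFDerivAt).mul (hud x).hasFDerivAt))
    refine (congrArg (fun L => L (EuclideanSpace.single i (1 : ℝ))) h.fderiv).trans ?_
    simp [EuclideanSpace.inner_single_right, h2, ← hsdef, ← hω]
    field_simp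
    ring
  have hn : ∑ i, x i ^ 2 = ‖x‖ ^ 2 := by
    rw [EuclideanSpace.norm_sq_eq]; simp
  have hL : eLap (fun y => carlemanWeight ε τ y * u y) x = ω * eLap u x
      - 2 * ω * (s / ‖x‖ ^ 2) * fderiv ℝ u x x
      + ω * u x / ‖x‖ ^ 4 * (s ^ 2 + τ * ε ^ 2 * ‖x‖ ^ ε + 2 * s) * ‖x‖ ^ 2
      - n * (ω * u x * s / ‖x‖ ^ 2) := by
    rw [eLap, Finset.sum_congr rfl fun i _ => key i]
    simp only [Finset.sum_add_distrib, ← Finset.mul_sum, Finset.sum_sub_distrib,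
      ← clm_apply_eq_sum, hn, Finset.sum_const, Finset.card_univ, Fintype.card_fin, nsmul_eq_mul]
    rfl
  rw [hL, fderiv_carlemanWeight_mul hx (hud x), real_inner_self_eq_norm_sq, h2, ← hsdef, ← hω]
  have hσ : τ * (1 - ε * ‖x‖ ^ ε) = s + n / 2 := by rw [hsdef]; ring
  rw [hσ]
  field_simp
  ring

theorem carleman_gradient_bound {u : EuclideanSpace ℝ (Fin n) → ℝ}
    {x : EuclideanSpace ℝ (Fin n)} (hx : x ≠ 0) (hu : DifferentiableAt ℝ u x) {ε τ : ℝ}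
    (hs : |τ * (1 - ε * ‖x‖ ^ ε) - n / 2| ≤ τ) :
    ‖x‖ ^ 2 * (carlemanWeight ε τ x * ‖gradient u x‖) ^ 2 ≤
      2 * (‖x‖ ^ 2 * ∑ i, fderiv ℝ (fun y => carlemanWeight ε τ y * u y) x
        (EuclideanSpace.single i 1) ^ 2) + 2 * τ ^ 2 * (carlemanWeight ε τ x * u x) ^ 2 := by
  have hpos : 0 < ‖x‖ := norm_pos_iff.2 hx
  have h2 : ‖x‖ ^ (-2 : ℝ) = (‖x‖ ^ 2)⁻¹ := by
    rw [Real.rpow_neg hpos.le]; norm_num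
  have hn : ∑ i, x i ^ 2 = ‖x‖ ^ 2 := by
    rw [EuclideanSpace.norm_sq_eq]; simp
  set s := τ * (1 - ε * ‖x‖ ^ ε) - n / 2 with hsdef
  set ω := carlemanWeight ε τ x with hω
  have hs2 : s ^ 2 ≤ τ ^ 2 := sq_le_sq' (abs_le.1 hs).1 (abs_le.1 hs).2
  have key : ∀ i : Fin n, ω ^ 2 * fderiv ℝ u x (EuclideanSpace.single i 1) ^ 2 ≤
      2 * fderiv ℝ (fun y => carlemanWeight ε τ y * u y) x (EuclideanSpace.single i 1) ^ 2
      + 2 * (s / ‖x‖ ^ 2 * (ω * u x)) ^ 2 * x i ^ 2 := by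
    intro i
    rw [fderiv_carlemanWeight_mul hx hu, EuclideanSpace.inner_single_right, h2, ← hsdef, ← hω]
    have := sq_nonneg (ω * fderiv ℝ u x (EuclideanSpace.single i 1)
      - 2 * (s / ‖x‖ ^ 2 * (ω * u x)) * x i)
    simp only [one_mul, starRingEnd_apply, star_trivial]
    rw [← div_eq_mul_inv]
    linear_combination this
  have hsum := Finset.sum_le_sum fun i (_ : i ∈ Finset.univ) => key i
  rw [Finset.sum_add_distrib, ← Finset.mul_sum, ← Finset.mul_sum, ← Finset.mul_sum, hn,
    ← norm_gradient_sq] at hsum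
  have h3 : ‖x‖ ^ 2 * (2 * (s / ‖x‖ ^ 2 * (ω * u x)) ^ 2 * ‖x‖ ^ 2) =
      2 * s ^ 2 * (ω * u x) ^ 2 := by
    field_simp
  have h4 : 2 * s ^ 2 * (ω * u x) ^ 2 ≤ 2 * τ ^ 2 * (ω * u x) ^ 2 := by gcongr
  have h5 := mul_le_mul_of_nonneg_left hsum (sq_nonneg ‖x‖)
  linear_combination h5 + h3 + h4

end Conjugation

section Estimate

variable {n : ℕ}

/-- The vector field whose divergence links `carlemanForm` to the conjugated operator. -/
noncomputable def carlemanFlux (ε τ : ℝ) (W v : EuclideanSpace ℝ (Fin n) → ℝ) (i : Fin n)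
    (y : EuclideanSpace ℝ (Fin n)) : ℝ :=
  ‖y‖ ^ (2 - n : ℝ) * (4 * ((τ * (1 - ε * ‖y‖ ^ ε) - 1) * fderiv ℝ v y y)
      - 4 * τ * ε ^ 2 * (‖y‖ ^ ε * v y)) * fderiv ℝ v y (EuclideanSpace.single i 1)
    + ‖y‖ ^ (-n : ℝ) * (-2 * ((τ * (1 - ε * ‖y‖ ^ ε) - 1) *
        (‖y‖ ^ 2 * ∑ i, fderiv ℝ v y (EuclideanSpace.single i 1) ^ 2))
      + (2 * ((τ * (1 - ε * ‖y‖ ^ ε) - 1) * ((τ * (1 - ε * ‖y‖ ^ ε) - 1) ^ 2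
          - τ * ε ^ 2 * ‖y‖ ^ ε - ((n - 2) / 2) ^ 2 + ‖y‖ ^ 2 * W y))
        + 2 * τ * ε ^ 3 * ‖y‖ ^ ε) * v y ^ 2) * y i

theorem carlemanForm_add_divergence_le {v W : EuclideanSpace ℝ (Fin n) → ℝ} (hv : ContDiff ℝ 2 v)
    (hW : ContDiff ℝ 1 W) {x : EuclideanSpace ℝ (Fin n)} (hx : x ≠ 0) (ε τ : ℝ) :
    ‖x‖ ^ (-n : ℝ) * carlemanForm ε τ (‖x‖ ^ ε) (‖x‖ ^ 2) (W x) (fderiv ℝ W x x) ((n - 2) / 2)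
        (‖x‖ ^ 2 * ∑ i, fderiv ℝ v x (EuclideanSpace.single i 1) ^ 2) (fderiv ℝ v x x) (v x)
      + ∑ i, fderiv ℝ (carlemanFlux ε τ W v i) x (EuclideanSpace.single i 1) ≤
    ‖x‖ ^ (-n : ℝ) * (‖x‖ ^ 2 * eLap v x - (n - 2) * fderiv ℝ v x x
      + 2 * (τ * (1 - ε * ‖x‖ ^ ε) - 1) * fderiv ℝ v x x
      + ((τ * (1 - ε * ‖x‖ ^ ε) - 1) ^ 2 - τ * ε ^ 2 * ‖x‖ ^ ε - ((n - 2) / 2) ^ 2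
        + ‖x‖ ^ 2 * W x) * v x) ^ 2 := by
  obtain ⟨hw, hw'⟩ := sum_fderiv_multiplier hv hx ε τ
  obtain ⟨hg, hg'⟩ := fderiv_euler_remainder hv hW hx ε τ ((n - 2) / 2)
  have h := sum_fderiv_flux hv hx hw hg
  rw [hw', hg'] at h
  have h' : ∑ i, fderiv ℝ (carlemanFlux ε τ W v i) x (EuclideanSpace.single i 1) = _ := h
  rw [h', ← mul_add]
  have hr : 0 ≤ ‖x‖ ^ (-n : ℝ) := by positivity
  refine mul_le_mul_of_nonneg_left ?_ hr
  unfold carlemanForm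
  linear_combination sq_nonneg (‖x‖ ^ 2 * eLap v x - (n - 2) * fderiv ℝ v x x
      + 2 * (τ * (1 - ε * ‖x‖ ^ ε) - 1) * fderiv ℝ v x x
      + ((τ * (1 - ε * ‖x‖ ^ ε) - 1) ^ 2 - τ * ε ^ 2 * ‖x‖ ^ ε - ((n - 2) / 2) ^ 2
        + ‖x‖ ^ 2 * W x) * v x
      - (2 * (τ * (1 - ε * ‖x‖ ^ ε) - 1) * fderiv ℝ v x x - 2 * τ * ε ^ 2 * ‖x‖ ^ ε * v x))

theorem contDiffAt_carlemanFlux {v W : EuclideanSpace ℝ (Fin n) → ℝ} (hv : ContDiff ℝ 2 v)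
    (hW : ContDiff ℝ 1 W) {x : EuclideanSpace ℝ (Fin n)} (hx : x ≠ 0) (ε τ : ℝ) (i : Fin n) :
    ContDiffAt ℝ 1 (carlemanFlux ε τ W v i) x := by
  have hv1 : ContDiff ℝ 1 v := hv.of_le (by norm_num)
  have hv' : ContDiff ℝ 1 (fderiv ℝ v) := hv.fderiv_right (by norm_num)
  have h1 := contDiffAt_norm_rpow hx (2 - n : ℝ) 1
  have h2 := contDiffAt_norm_rpow hx (-n : ℝ) 1
  have h3 := contDiffAt_norm_rpow hx ε 1
  have h4 : ContDiff ℝ 1 fun y : EuclideanSpace ℝ (Fin n) => ‖y‖ ^ 2 := contDiff_norm_sq ℝ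
  have h5 : ContDiff ℝ 1 fun y : EuclideanSpace ℝ (Fin n) => y i :=
    (EuclideanSpace.proj (𝕜 := ℝ) i).contDiff
  unfold carlemanFlux
  fun_prop

/-- Integrated form of the estimate, with squared norms. -/
theorem carleman_integral_estimate (hn : 2 ≤ n) {ε : ℝ} (hε0 : 0 < ε) (hε1 : ε < 1)
    {u W : EuclideanSpace ℝ (Fin n) → ℝ} (hu : ContDiff ℝ (⊤ : ℕ∞) u) (hW : ContDiff ℝ 1 W)
    (hc : HasCompactSupport u) (hs : tsupport u ⊆ ball (0 : EuclideanSpace ℝ (Fin n)) 1 \ {0})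
    {τ M β : ℝ} (hβ : β = (1 - ε) / 2)
    (hWM : ∀ x ∈ ball (0 : EuclideanSpace ℝ (Fin n)) 1, |W x| ≤ M)
    (hVM : ∀ x ∈ ball (0 : EuclideanSpace ℝ (Fin n)) 1, |fderiv ℝ W x x| ≤ M)
    (hM : 36 * M ≤ (ε * β * τ) ^ 2) (hτ : 16 ≤ β ^ 2 * τ) (hτn : n ≤ τ) :
    τ ^ 3 * (∫ x, (‖x‖ ^ (ε / 2) * Real.exp (τ * (-Real.log ‖x‖ + ‖x‖ ^ ε)) * u x) ^ 2) +
      τ * (∫ x, (‖x‖ ^ (1 + ε / 2) * Real.exp (τ * (-Real.log ‖x‖ + ‖x‖ ^ ε)) *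
              ‖gradient u x‖) ^ 2) ≤
    3 / (β ^ 2 * ε ^ 2) * ∫ x, (‖x‖ ^ (2 : ℝ) * Real.exp (τ * (-Real.log ‖x‖ + ‖x‖ ^ ε)) *
          (eLap u x + W x * u x)) ^ 2 := by
  have hτ0 : 0 < τ := lt_of_lt_of_le (by norm_cast; omega) hτn
  set K := tsupport u with hKdef
  have hK : IsCompact K := hc
  have h0 : (0 : EuclideanSpace ℝ (Fin n)) ∉ K := fun h => (hs h).2 rfl
  have hu0 : ∀ x ∉ K, u x = 0 := fun x hx => image_eq_zero_of_notMem_tsupport hx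
  have hu2 : ContDiff ℝ 2 u := mod_cast contDiff_infty.1 hu 2
  have hgu0 : ∀ x ∉ K, gradient u x = 0 := fun x hx => by
    rw [gradient, fderiv_eq_zero_of_notMem hK hu0 hx, map_zero]
  have hLu0 : ∀ x ∉ K, eLap u x = 0 := fun x hx => eLap_eq_zero_of_notMem hK hu0 hx
  set v : EuclideanSpace ℝ (Fin n) → ℝ := fun y => carlemanWeight ε τ y * u y with hvdef
  have hv0 : ∀ x ∉ K, v x = 0 := fun x hx => by simp [hvdef, hu0 x hx]
  have hv : ContDiff ℝ 2 v := contDiff_of_contDiffAt_ne_zero hK h0 hv0 fun x hx =>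
    (contDiffAt_carlemanWeight hx ε τ 2).mul hu2.contDiffAt
  have hF0 : ∀ i, ∀ x ∉ K, carlemanFlux ε τ W v i x = 0 := fun i x hx => by
    simp [carlemanFlux, hv0 x hx, fderiv_eq_zero_of_notMem hK hv0 hx]
  have hFd : ∀ i, ∀ x ≠ 0, ContDiffAt ℝ 1 (carlemanFlux ε τ W v i) x := fun i x hx =>
    contDiffAt_carlemanFlux hv hW hx ε τ i
  obtain ⟨hdivi, hdiv⟩ := integral_divergence_eq_zero hK h0 hF0 hFd
  have hexp : ∀ x : EuclideanSpace ℝ (Fin n), x ≠ 0 →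
      ContinuousAt (fun x => Real.exp (τ * (-Real.log ‖x‖ + ‖x‖ ^ ε))) x := fun x hx =>
    (((continuousAt_const.mul (((continuous_norm.continuousAt.log
      (norm_ne_zero_iff.2 hx)).neg.add (contDiffAt_norm_rpow hx ε 0).continuousAt))))).rexp
  have hA : Integrable fun x =>
      (‖x‖ ^ (ε / 2) * Real.exp (τ * (-Real.log ‖x‖ + ‖x‖ ^ ε)) * u x) ^ 2 :=
    integrable_of_continuousAt_ne_zero hK h0 (fun x hx => by simp [hu0 x hx]) fun x hx =>
      (((contDiffAt_norm_rpow hx _ 0).continuousAt.mul (hexp x hx)).mul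
        hu.continuous.continuousAt).pow 2
  have hgc : Continuous (gradient u) :=
    (InnerProductSpace.toDual ℝ (EuclideanSpace ℝ (Fin n))).symm.continuous.comp
      (hu2.continuous_fderiv two_ne_zero)
  have hB : Integrable fun x =>
      (‖x‖ ^ (1 + ε / 2) * Real.exp (τ * (-Real.log ‖x‖ + ‖x‖ ^ ε)) * ‖gradient u x‖) ^ 2 :=
    integrable_of_continuousAt_ne_zero hK h0 (fun x hx => by simp [hgu0 x hx]) fun x hx =>
      (((contDiffAt_norm_rpow hx _ 0).continuousAt.mul (hexp x hx)).mul
        hgc.norm.continuousAt).pow 2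
  have hLc : Continuous (eLap u) := by
    refine continuous_finsetSum _ fun i _ => ?_
    have h1 : ContDiff ℝ 1 fun y => fderiv ℝ u y (EuclideanSpace.single i 1) :=
      (hu2.fderiv_right (m := 1) (by norm_num)).clm_apply contDiff_const
    exact (h1.continuous_fderiv one_ne_zero).clm_apply continuous_const
  have hR : Integrable fun x =>
      (‖x‖ ^ (2 : ℝ) * Real.exp (τ * (-Real.log ‖x‖ + ‖x‖ ^ ε)) * (eLap u x + W x * u x)) ^ 2 :=
    integrable_of_continuousAt_ne_zero hK h0 (fun x hx => by simp [hu0 x hx, hLu0 x hx])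
      fun x hx => (((contDiffAt_norm_rpow hx _ 0).continuousAt.mul (hexp x hx)).mul
        (hLc.add (hW.continuous.mul hu.continuous)).continuousAt).pow 2
  rw [← integral_const_mul, ← integral_const_mul, ← integral_add (hA.const_mul _) (hB.const_mul _),
    ← sub_zero (∫ x, (‖x‖ ^ (2 : ℝ) * Real.exp (τ * (-Real.log ‖x‖ + ‖x‖ ^ ε)) *
      (eLap u x + W x * u x)) ^ 2), ← hdiv, ← integral_sub hR hdivi, ← integral_const_mul]
  refine integral_mono ((hA.const_mul _).add (hB.const_mul _)) ((hR.sub hdivi).const_mul _)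
    fun x => ?_
  by_cases hxK : x ∈ K
  swap
  · have hd0 : ∀ i, fderiv ℝ (carlemanFlux ε τ W v i) x = 0 := fun i =>
      fderiv_eq_zero_of_notMem hK (hF0 i) hxK
    simp [hu0 x hxK, hgu0 x hxK, hLu0 x hxK, hd0]
  have hx : x ≠ 0 := fun h => h0 (h ▸ hxK)
  have hxb : x ∈ ball (0 : EuclideanSpace ℝ (Fin n)) 1 := (hs hxK).1
  have hpos : 0 < ‖x‖ := norm_pos_iff.2 hx
  have hx1 : ‖x‖ ≤ 1 := (mem_ball_zero_iff.1 hxb).le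
  have hN0 : 0 < ‖x‖ ^ ε := by positivity
  have hN1 : ‖x‖ ^ ε ≤ 1 := Real.rpow_le_one hpos.le hx1 hε0.le
  have hρN : ‖x‖ ^ 2 ≤ ‖x‖ ^ ε := by
    rw [← Real.rpow_natCast]
    exact Real.rpow_le_rpow_of_exponent_ge hpos hx1 (by push_cast; linarith)
  have hsτ : |τ * (1 - ε * ‖x‖ ^ ε) - n / 2| ≤ τ := by
    have h1 : 0 ≤ τ * (ε * ‖x‖ ^ ε) := by positivity
    have h2 : τ * (ε * ‖x‖ ^ ε) ≤ τ * 1 := by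
      gcongr
      nlinarith
    have h3 : (0 : ℝ) ≤ n := by positivity
    rw [abs_le]
    constructor <;> linarith
  have hform := carleman_quadratic_bound (ν := (n - 2) / 2) (p := fderiv ℝ v x x) (v := v x)
    (G := ‖x‖ ^ 2 * ∑ i, fderiv ℝ v x (EuclideanSpace.single i 1) ^ 2)
    hε0 hε1 hβ hN0 hN1 (by positivity) hρN (hWM x hxb) (hVM x hxb) hM hτ (by positivity)
  have hflux := carlemanForm_add_divergence_le hv hW hx ε τ
  have hgrad := carleman_gradient_bound hx (hu2.differentiable two_ne_zero x) hsτ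
  rw [hvdef, carleman_conjugation hu2 hx ε τ (W x), ← hvdef] at hflux
  set E := Real.exp (τ * (-Real.log ‖x‖ + ‖x‖ ^ ε)) with hE
  have hr0 : 0 < ‖x‖ ^ (-n : ℝ) := by positivity
  have hω : ‖x‖ ^ (-n : ℝ) * carlemanWeight ε τ x ^ 2 = E ^ 2 := by
    rw [carlemanWeight, ← hE, mul_pow, ← Real.rpow_natCast (‖x‖ ^ (n / 2 : ℝ)),
      ← Real.rpow_mul hpos.le, mul_left_comm, ← Real.rpow_add hpos]
    simp
  have hp1 : (‖x‖ ^ (ε / 2)) ^ 2 = ‖x‖ ^ ε := by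
    rw [← Real.rpow_natCast, ← Real.rpow_mul hpos.le]; congr 1; push_cast; ring
  have hp2 : (‖x‖ ^ (1 + ε / 2)) ^ 2 = ‖x‖ ^ 2 * ‖x‖ ^ ε := by
    rw [Real.rpow_add hpos, mul_pow, hp1, Real.rpow_one]
  have hK0 : 0 < 3 / (β ^ 2 * ε ^ 2) := by
    have : 0 < β := by rw [hβ]; linarith
    positivity
  have e1 := mul_le_mul_of_nonneg_left hform hr0.le
  have e2 := mul_le_mul_of_nonneg_left hflux hK0.le
  have e3 := mul_le_mul_of_nonneg_left hgrad (mul_pos (mul_pos hτ0 hN0) hr0).le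
  have hv1 : v x = carlemanWeight ε τ x * u x := rfl
  simp only [mul_pow, hp1, hp2, Real.rpow_two, ← hω]
  rw [hv1] at e1 e2
  linear_combination e1 + e2 + e3

theorem bddAbove_image_ball {f : EuclideanSpace ℝ (Fin n) → ℝ} (hf : Continuous f) (R : ℝ) :
    BddAbove (f '' ball (0 : EuclideanSpace ℝ (Fin n)) R) :=
  ((isCompact_closedBall 0 R).image hf).bddAbove.mono (Set.image_mono ball_subset_closedBall)

theorem norm_gradient_eq (f : EuclideanSpace ℝ (Fin n) → ℝ) (x : EuclideanSpace ℝ (Fin n)) :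
    ‖gradient f x‖ = ‖fderiv ℝ f x‖ := by
  rw [← toDual_gradient (𝕜 := ℝ) (f := f), LinearIsometryEquiv.norm_map]

theorem abs_add_norm_fderiv_le_eC1Norm {W : EuclideanSpace ℝ (Fin n) → ℝ} (hW : ContDiff ℝ 1 W)
    {R : ℝ} {x : EuclideanSpace ℝ (Fin n)} (hx : x ∈ ball (0 : EuclideanSpace ℝ (Fin n)) R) :
    |W x| + ‖fderiv ℝ W x‖ ≤ eC1Norm W R := by
  refine add_le_add
    (le_csSup (bddAbove_image_ball hW.continuous.abs R) (Set.mem_image_of_mem _ hx)) ?_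
  simp only [norm_gradient_eq]
  exact le_csSup (bddAbove_image_ball (hW.continuous_fderiv one_ne_zero).norm R)
    (Set.mem_image_of_mem _ hx)

end Estimate

/-- Carleman estimate for `Δ + W` with weight `φ(x) = -log|x| + |x|^ε`
(Euclidean-metric case of Theorem 2.1, inequality (S)). -/
theorem carleman_estimate_scalar (n : ℕ) (hn : 2 ≤ n) (ε : ℝ) (hε0 : 0 < ε) (hε1 : ε < 1) :
    ∃ R₀ C C₁ C₂ : ℝ, 0 < R₀ ∧ 0 < C ∧ 0 < C₁ ∧ 0 < C₂ ∧
      ∀ W : EuclideanSpace ℝ (Fin n) → ℝ, ContDiff ℝ 1 W →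
      ∀ u : EuclideanSpace ℝ (Fin n) → ℝ, ContDiff ℝ (⊤ : ℕ∞) u → HasCompactSupport u →
        tsupport u ⊆ ball (0 : EuclideanSpace ℝ (Fin n)) R₀ \ {0} →
      ∀ τ : ℝ, C₁ * Real.sqrt (eC1Norm W R₀) + C₂ ≤ τ →
        τ ^ ((3 : ℝ) / 2) *
            eL2 (fun x => ‖x‖ ^ (ε / 2) * Real.exp (τ * (-Real.log ‖x‖ + ‖x‖ ^ ε)) * u x) +
          τ ^ ((1 : ℝ) / 2) *
            eL2 (fun x => ‖x‖ ^ (1 + ε / 2) * Real.exp (τ * (-Real.log ‖x‖ + ‖x‖ ^ ε)) *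
              ‖gradient u x‖) ≤
        C * eL2 (fun x => ‖x‖ ^ (2 : ℝ) * Real.exp (τ * (-Real.log ‖x‖ + ‖x‖ ^ ε)) *
          (eLap u x + W x * u x)) := by
  obtain ⟨β, hβ⟩ : ∃ β : ℝ, β = (1 - ε) / 2 := ⟨_, rfl⟩
  have hβ0 : 0 < β := by rw [hβ]; linarith
  refine ⟨1, Real.sqrt (2 * (3 / (β ^ 2 * ε ^ 2))), 6 / (ε * β), 16 / β ^ 2 + n, one_pos,
    by positivity, by positivity, by positivity, fun W hW u hu hc hs τ hτ => ?_⟩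
  set M := eC1Norm W 1 with hMdef
  have hb : ∀ x ∈ ball (0 : EuclideanSpace ℝ (Fin n)) 1, |W x| + ‖fderiv ℝ W x‖ ≤ M :=
    fun x hx => abs_add_norm_fderiv_le_eC1Norm hW hx
  have hM0 : 0 ≤ M := (by positivity : 0 ≤ |W 0| + ‖fderiv ℝ W 0‖).trans (hb 0 (by simp))
  have hq : 0 ≤ 6 / (ε * β) * Real.sqrt M := by positivity
  have hq2 : 0 < 16 / β ^ 2 := by positivity
  have hn0 : (0 : ℝ) ≤ n := by positivity
  have hτ0 : 0 < τ := by linarith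
  have hM : 36 * M ≤ (ε * β * τ) ^ 2 := by
    have h1 : 6 / (ε * β) * Real.sqrt M ≤ τ := by linarith
    rw [div_mul_eq_mul_div, div_le_iff₀ (by positivity)] at h1
    have h2 := pow_le_pow_left₀ (by positivity) h1 2
    rw [mul_pow, Real.sq_sqrt hM0] at h2
    linarith
  have hτβ : 16 ≤ β ^ 2 * τ := by
    have h1 : 16 / β ^ 2 ≤ τ := by linarith
    rw [div_le_iff₀ (by positivity)] at h1
    linarith
  have key := carleman_integral_estimate hn hε0 hε1 hu hW hc hs hβ
    (fun x hx => (le_add_of_nonneg_right (norm_nonneg _)).trans (hb x hx))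
    (fun x hx => by
      have h1 := (fderiv ℝ W x).le_opNorm x
      have h2 : ‖fderiv ℝ W x‖ * ‖x‖ ≤ ‖fderiv ℝ W x‖ * 1 := by
        gcongr
        exact (mem_ball_zero_iff.1 hx).le
      rw [Real.norm_eq_abs] at h1
      linarith [hb x hx, abs_nonneg (W x)])
    hM hτβ (by linarith)
  unfold eL2
  set A := ∫ x, (‖x‖ ^ (ε / 2) * Real.exp (τ * (-Real.log ‖x‖ + ‖x‖ ^ ε)) * u x) ^ 2
  set B := ∫ x, (‖x‖ ^ (1 + ε / 2) * Real.exp (τ * (-Real.log ‖x‖ + ‖x‖ ^ ε)) *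
    ‖gradient u x‖) ^ 2
  set R := ∫ x, (‖x‖ ^ (2 : ℝ) * Real.exp (τ * (-Real.log ‖x‖ + ‖x‖ ^ ε)) *
    (eLap u x + W x * u x)) ^ 2
  have hA : 0 ≤ A := integral_nonneg fun x => sq_nonneg _
  have hB : 0 ≤ B := integral_nonneg fun x => sq_nonneg _
  rw [← Real.sqrt_mul (by positivity)]
  refine Real.le_sqrt_of_sq_le ?_
  have h3 : (τ ^ ((3 : ℝ) / 2)) ^ 2 = τ ^ 3 := by
    rw [← Real.rpow_natCast, ← Real.rpow_natCast, ← Real.rpow_mul hτ0.le]; norm_num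
  have h1 : (τ ^ ((1 : ℝ) / 2)) ^ 2 = τ := by
    rw [← Real.rpow_natCast, ← Real.rpow_mul hτ0.le]; norm_num
  have hsq := add_sq_le (a := τ ^ ((3 : ℝ) / 2) * Real.sqrt A)
    (b := τ ^ ((1 : ℝ) / 2) * Real.sqrt B)
  rw [mul_pow, mul_pow, h3, h1, Real.sq_sqrt hA, Real.sq_sqrt hB] at hsq
  linarith
end
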